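/- Let A ⊆ ℤ³ be nonempty and finite, and let v ∈ ℤ³. If there exist two distinct points u, w ∈ A each grid-adjacent to v, then v lies in the minimum bounding box Box(A) of A; consequently Box(A ∪ {v}) = Box(A). In other words, adding a cell at a site adjacent to two distinct cells of an assembly never enlarges the minimum bounding box. -/

import Mathlib

/-- Two points of `ℤ³` are grid-adjacent if they differ by exactly 1 in one
coordinate and agree in the other two. -/
def gridAdjacent (p q : Fin 3 → ℤ) : Prop :=
  ∃ j, (p j - q j = 1 ∨ q j - p j = 1) ∧ ∀ k, k ≠ j → p k = q k

/-- The minimum bounding box of a nonempty finite set `A ⊆ ℤ³`: all points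
whose coordinates lie between the coordinatewise minima and maxima of `A`. -/
def bboxOf (A : Finset (Fin 3 → ℤ)) (hA : A.Nonempty) : Set (Fin 3 → ℤ) :=
  {p | ∀ j : Fin 3,
    (A.image fun q => q j).min' (hA.image _) ≤ p j ∧
    p j ≤ (A.image fun q => q j).max' (hA.image _)}

theorem mem_bboxOf_iff {A : Finset (Fin 3 → ℤ)} {hA : A.Nonempty} {p : Fin 3 → ℤ} :
    p ∈ bboxOf A hA ↔ ∀ j, (∃ a ∈ A, a j ≤ p j) ∧ ∃ b ∈ A, p j ≤ b j := by
  refine forall_congr' fun j => and_congr ⟨fun h => ?_, ?_⟩ ⟨fun h => ?_, ?_⟩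
  · obtain ⟨a, ha, haj⟩ := Finset.mem_image.mp (Finset.min'_mem (A.image fun q => q j) (hA.image _))
    exact ⟨a, ha, haj.trans_le h⟩
  · rintro ⟨a, ha, haj⟩
    exact (Finset.min'_le _ _ (Finset.mem_image_of_mem (fun q => q j) ha)).trans haj
  · obtain ⟨b, hb, hbj⟩ := Finset.mem_image.mp (Finset.max'_mem (A.image fun q => q j) (hA.image _))
    exact ⟨b, hb, h.trans_eq hbj.symm⟩
  · rintro ⟨b, hb, hbj⟩
    exact hbj.trans (Finset.le_max' _ _ (Finset.mem_image_of_mem (fun q => q j) hb))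

/-- Inserting a point of the bounding box does not change the bounding box. -/
theorem bboxOf_insert_of_mem {A : Finset (Fin 3 → ℤ)} {hA : A.Nonempty} {v : Fin 3 → ℤ}
    (hv : v ∈ bboxOf A hA) :
    bboxOf (insert v A) (Finset.insert_nonempty v A) = bboxOf A hA := by
  ext p
  rw [mem_bboxOf_iff] at hv
  simp only [mem_bboxOf_iff, Finset.exists_mem_insert]
  refine forall_congr' fun j => ?_
  obtain ⟨⟨a, ha, hav⟩, b, hb, hvb⟩ := hv j
  exact and_congr
    (or_iff_right_of_imp fun h => ⟨a, ha, hav.trans h⟩)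
    (or_iff_right_of_imp fun h => ⟨b, hb, h.trans hvb⟩)

/-- A point grid-adjacent to two distinct points lies coordinatewise between them. -/
theorem gridAdjacent.between {u v w : Fin 3 → ℤ} (hu : gridAdjacent u v)
    (hw : gridAdjacent w v) (huw : u ≠ w) (j : Fin 3) :
    (u j ≤ v j ∧ v j ≤ w j) ∨ (w j ≤ v j ∧ v j ≤ u j) := by
  obtain ⟨i, hi, hu⟩ := hu
  obtain ⟨k, hk, hw⟩ := hw
  by_cases hji : j = i
  · by_cases hjk : j = k
    · subst hji hjk
      have hne : u j ≠ w j := fun h => huw <| funext fun l => by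
        by_cases hl : l = j
        · rw [hl, h]
        · rw [hu l hl, hw l hl]
      omega
    · have := hw j hjk
      omega
  · have := hu j hji
    omega

/-- Adding a cell at a site adjacent to two distinct cells of an assembly
never enlarges the minimum bounding box. -/
theorem stmt11 (A : Finset (Fin 3 → ℤ)) (hA : A.Nonempty)
    (v u w : Fin 3 → ℤ) (hu : u ∈ A) (hw : w ∈ A) (huw : u ≠ w)
    (hadju : gridAdjacent u v) (hadjw : gridAdjacent w v) :
    v ∈ bboxOf A hA ∧
    bboxOf (insert v A) (Finset.insert_nonempty v A) = bboxOf A hA := by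
  have hv : v ∈ bboxOf A hA := mem_bboxOf_iff.mpr fun j => by
    rcases hadju.between hadjw huw j with ⟨h₁, h₂⟩ | ⟨h₁, h₂⟩
    · exact ⟨⟨u, hu, h₁⟩, w, hw, h₂⟩
    · exact ⟨⟨w, hw, h₁⟩, u, hu, h₂⟩
  exact ⟨hv, bboxOf_insert_of_mem hv⟩
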